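/- E(q²)⁷E(q³)E(q^{12}) / (E(q)³E(q⁴)³E(q⁶)) - 2E(q⁴)³E(q⁶)² / (E(q²)²E(q^{12})) = -E(q)³E(q⁶)² / (E(q²)²E(q³)), where E(q) = (q;q)_∞. -/

import Mathlib

open scoped BigOperators

/-- Euler function $E(q) = (q;q)_\infty = \prod_{j\ge1}(1-q^j)$. -/
noncomputable def eulerE (q : ℂ) : ℂ := ∏' j : ℕ, (1 - q * q ^ j)

open Filter Topology

/-- The product `∏_{k≥0} (1 + z p^(2k+1))`. -/
noncomputable def oddProd (z p : ℂ) : ℂ := ∏' k : ℕ, (1 + z * p ^ (2 * k + 1))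

lemma summable_norm_mul_pow_odd (z : ℂ) {p : ℂ} (hp : ‖p‖ < 1) :
    Summable fun k : ℕ => ‖z * p ^ (2 * k + 1)‖ := by
  have h : Summable fun k : ℕ => ‖p‖ ^ (2 * k + 1) :=
    (summable_geometric_of_lt_one (norm_nonneg p) hp).comp_injective
      (i := fun k : ℕ => 2 * k + 1) fun a b hab => by simpa using hab
  simpa [norm_mul, norm_pow] using h.mul_left ‖z‖

lemma multipliable_oddProd (z : ℂ) {p : ℂ} (hp : ‖p‖ < 1) :
    Multipliable fun k : ℕ => 1 + z * p ^ (2 * k + 1) :=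
  multipliable_one_add_of_summable (summable_norm_mul_pow_odd z hp)

lemma one_add_mul_pow_ne_zero {z p : ℂ} (hz : ‖z‖ = 1) (hp : ‖p‖ < 1) (n : ℕ) :
    1 + z * p ^ (n + 1) ≠ 0 := by
  intro h
  have h1 : ‖z * p ^ (n + 1)‖ = 1 := by
    rw [eq_neg_of_add_eq_zero_right h, norm_neg, norm_one]
  rw [norm_mul, hz, one_mul, norm_pow] at h1
  exact (pow_lt_one₀ (norm_nonneg p) hp n.succ_ne_zero).ne h1

lemma oddProd_ne_zero {z p : ℂ} (hz : ‖z‖ = 1) (hp : ‖p‖ < 1) : oddProd z p ≠ 0 :=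
  tprod_one_add_ne_zero_of_summable (fun k => one_add_mul_pow_ne_zero hz hp (2 * k))
    (summable_norm_mul_pow_odd z hp)

lemma multipliable_eulerE {q : ℂ} (hq : ‖q‖ < 1) : Multipliable fun j : ℕ => 1 - q * q ^ j := by
  simpa [pow_succ'] using ModularForm.multipliable_one_sub_pow hq

lemma eulerE_ne_zero {q : ℂ} (hq : ‖q‖ < 1) : eulerE q ≠ 0 := by
  have hs := (summable_nat_add_iff 1).mpr (summable_geometric_of_lt_one (norm_nonneg q) hq)
  have h := tprod_one_add_ne_zero_of_summable (f := fun j : ℕ => -1 * q ^ (j + 1))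
    (one_add_mul_pow_ne_zero (by simp) hq)
    (by simpa using hs)
  simpa [eulerE, pow_succ', sub_eq_add_neg] using h

lemma norm_pow_lt_one {q : ℂ} (hq : ‖q‖ < 1) {n : ℕ} (hn : n ≠ 0) : ‖q ^ n‖ < 1 := by
  rw [norm_pow]
  exact pow_lt_one₀ (norm_nonneg q) hq hn

lemma eulerE_eq_oddProd_mul {q : ℂ} (hq : ‖q‖ < 1) :
    eulerE q = oddProd (-1) q * eulerE (q ^ 2) := by
  have he : (fun k : ℕ => 1 - q * q ^ (2 * k)) = fun k : ℕ => 1 + -1 * q ^ (2 * k + 1) := by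
    funext k; ring
  have ho : (fun k : ℕ => 1 - q * q ^ (2 * k + 1)) = fun k : ℕ => 1 - q ^ 2 * (q ^ 2) ^ k := by
    funext k; ring
  have h := tprod_even_mul_odd (f := fun k : ℕ => 1 - q * q ^ k)
    (by simpa only [he] using multipliable_oddProd (-1) hq)
    (by simpa only [ho] using multipliable_eulerE (norm_pow_lt_one hq two_ne_zero))
  simp only [he, ho] at h
  exact h.symm

lemma oddProd_neg_one_mul {q : ℂ} (hq : ‖q‖ < 1) :
    oddProd (-1) q * oddProd (-1) (-q) = oddProd (-1) (q ^ 2) := by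
  have hq' : ‖-q‖ < 1 := by rwa [norm_neg]
  unfold oddProd
  rw [← (multipliable_oddProd (-1) hq).tprod_mul (multipliable_oddProd (-1) hq')]
  refine tprod_congr fun k => ?_
  rw [Odd.neg_pow ⟨k, rfl⟩]
  ring

/-- The identity `E(q) E(-q) E(q⁴) = E(q²)³`. -/
lemma eulerE_mul_eulerE_neg {q : ℂ} (hq : ‖q‖ < 1) :
    eulerE q * eulerE (-q) * eulerE (q ^ 4) = eulerE (q ^ 2) ^ 3 := by
  have hq' : ‖-q‖ < 1 := by rwa [norm_neg]
  have h1 := eulerE_eq_oddProd_mul hq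
  have h2 := eulerE_eq_oddProd_mul hq'
  have h3 := eulerE_eq_oddProd_mul (norm_pow_lt_one hq two_ne_zero)
  have h4 := oddProd_neg_one_mul hq
  rw [neg_sq] at h2
  rw [← pow_mul] at h3
  norm_num at h3
  linear_combination eulerE (-q) * eulerE (q ^ 4) * h1 +
    oddProd (-1) q * eulerE (q ^ 2) * eulerE (q ^ 4) * h2 +
    eulerE (q ^ 2) ^ 2 * eulerE (q ^ 4) * h4 - eulerE (q ^ 2) ^ 2 * h3

lemma oddProd_cubic {ω p : ℂ} (hω : ω ^ 2 + ω + 1 = 0) (hp : ‖p‖ < 1) :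
    oddProd 1 p * oddProd ω p * oddProd (ω ^ 2) p = oddProd 1 (p ^ 3) := by
  unfold oddProd
  rw [← (multipliable_oddProd 1 hp).tprod_mul (multipliable_oddProd ω hp),
    ← ((multipliable_oddProd 1 hp).mul (multipliable_oddProd ω hp)).tprod_mul
      (multipliable_oddProd (ω ^ 2) hp)]
  refine tprod_congr fun k => ?_
  rw [← pow_mul, mul_comm 3, pow_mul]
  generalize p ^ (2 * k + 1) = t
  linear_combination (t + t ^ 2 * ω + t ^ 3 * (ω - 1)) * hω

/-- The reciprocal `1 / ((1 - q) ⋯ (1 - q^k))`, extended by zero to negative `k`. -/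
noncomputable def invPoch (q : ℂ) (k : ℤ) : ℂ :=
  if 0 ≤ k then (∏ i ∈ Finset.range k.toNat, (1 - q * q ^ i))⁻¹ else 0

lemma one_sub_mul_pow_ne_zero {q : ℂ} (hq : ‖q‖ < 1) (n : ℕ) : 1 - q * q ^ n ≠ 0 := by
  simpa [pow_succ', sub_eq_add_neg] using
    one_add_mul_pow_ne_zero (z := -1) (by simp) hq n

lemma invPoch_sub_one {q : ℂ} (hq : ‖q‖ < 1) (k : ℤ) :
    invPoch q (k - 1) = (1 - q ^ k) * invPoch q k := by
  rcases lt_trichotomy k 0 with hk | rfl | hk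
  · simp [invPoch, not_le.mpr hk, show ¬ (1 ≤ k) by omega]
  · simp [invPoch]
  · obtain ⟨n, rfl⟩ : ∃ n : ℕ, k = n + 1 := ⟨(k - 1).toNat, by omega⟩
    have h := one_sub_mul_pow_ne_zero hq n
    have h1 : ((n : ℤ) + 1).toNat = n + 1 := by omega
    have h2 : q ^ ((n : ℤ) + 1) = q * q ^ n := by
      rw [← pow_succ']; exact_mod_cast zpow_natCast q (n + 1)
    rw [add_sub_cancel_right, invPoch, invPoch, if_pos (by omega), if_pos (by omega), h1,
      Int.toNat_natCast, Finset.prod_range_succ, mul_inv, h2]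
    field_simp

/-- Coefficients of the finite form of the Jacobi triple product. -/
noncomputable def tripleCoeff (q : ℂ) (n : ℕ) (j : ℤ) : ℂ :=
  (∏ i ∈ Finset.range (2 * n), (1 - q * q ^ i)) * (invPoch q (n + j) * invPoch q (n - j))

lemma tripleCoeff_zero (q : ℂ) (j : ℤ) : tripleCoeff q 0 j = if j = 0 then 1 else 0 := by
  rcases lt_trichotomy j 0 with hj | rfl | hj
  · simp [tripleCoeff, invPoch, hj.ne, not_le.mpr hj]
  · simp [tripleCoeff, invPoch]
  · simp [tripleCoeff, invPoch, hj.ne', not_le.mpr hj]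

lemma tripleCoeff_succ {q : ℂ} (hq0 : q ≠ 0) (hq : ‖q‖ < 1) (n : ℕ) (j : ℤ) :
    tripleCoeff q (n + 1) j = (1 + q ^ (2 * n + 1)) * tripleCoeff q n j
      + q ^ (n + 1 - j : ℤ) * tripleCoeff q n (j - 1)
      + q ^ (n + 1 + j : ℤ) * tripleCoeff q n (j + 1) := by
  have e1 := invPoch_sub_one hq (n + 1 + j)
  have e2 := invPoch_sub_one hq (n + 1 - j)
  have e3 := invPoch_sub_one hq (n + 1 + j - 1)
  have e4 := invPoch_sub_one hq (n + 1 - j - 1)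
  have hUV : q ^ (n + 1 + j : ℤ) * q ^ (n + 1 - j : ℤ) = q * q ^ (2 * n + 1) := by
    rw [← zpow_add₀ hq0, ← pow_succ', ← zpow_natCast]
    congr 1; push_cast; ring
  rw [zpow_sub_one₀ hq0] at e3 e4
  simp only [tripleCoeff, show 2 * (n + 1) = 2 * n + 1 + 1 by ring, Finset.prod_range_succ,
    show ((n + 1 : ℕ) : ℤ) = (n : ℤ) + 1 by push_cast; ring,
    show (n : ℤ) + j = n + 1 + j - 1 by ring, show (n : ℤ) - j = n + 1 - j - 1 by ring,
    show (n : ℤ) + (j - 1) = n + 1 + j - 1 - 1 by ring,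
    show (n : ℤ) - (j - 1) = n + 1 - j by ring,
    show (n : ℤ) + (j + 1) = n + 1 + j by ring,
    show (n : ℤ) - (j + 1) = n + 1 - j - 1 - 1 by ring, e3, e4, e1, e2]
  have hW : q ^ (2 * n + 1) = q ^ (n + 1 + j : ℤ) * q ^ (n + 1 - j : ℤ) * q⁻¹ := by
    rw [hUV]; field_simp
  have hW' : q ^ (2 * n) = q ^ (n + 1 + j : ℤ) * q ^ (n + 1 - j : ℤ) * q⁻¹ * q⁻¹ := by
    rw [← hW, pow_succ]; field_simp
  rw [hW, hW']
  field_simp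
  ring

/-- The finite Jacobi triple product. -/
lemma hasSum_finite_triple {y p : ℂ} (hy : y ≠ 0) (hp0 : p ≠ 0) (hp : ‖p‖ < 1) (n : ℕ) :
    HasSum (fun j : ℤ => y ^ j * p ^ (j ^ 2) * tripleCoeff (p ^ 2) n j)
      (∏ k ∈ Finset.range n, (1 + y * p ^ (2 * k + 1)) * (1 + y⁻¹ * p ^ (2 * k + 1))) := by
  induction n with
  | zero =>
    rw [Finset.prod_range_zero]
    refine (hasSum_ite_eq (0 : ℤ) (1 : ℂ)).congr_fun fun j => ?_
    rw [tripleCoeff_zero]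
    split_ifs with h <;> simp [h]
  | succ n ih =>
    rw [Finset.prod_range_succ]
    have hs := ((ih.mul_left (1 + p ^ (4 * n + 2))).add
      (((Equiv.subRight (1 : ℤ)).hasSum_iff.mpr ih).mul_left (y * p ^ (2 * n + 1)))).add
      (((Equiv.addRight (1 : ℤ)).hasSum_iff.mpr ih).mul_left (y⁻¹ * p ^ (2 * n + 1)))
    have hf : (fun j : ℤ => y ^ j * p ^ (j ^ 2) * tripleCoeff (p ^ 2) (n + 1) j) = fun j : ℤ =>
        (1 + p ^ (4 * n + 2)) * (y ^ j * p ^ (j ^ 2) * tripleCoeff (p ^ 2) n j) +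
        y * p ^ (2 * n + 1) *
          (y ^ (j - 1) * p ^ ((j - 1) ^ 2) * tripleCoeff (p ^ 2) n (j - 1)) +
        y⁻¹ * p ^ (2 * n + 1) *
          (y ^ (j + 1) * p ^ ((j + 1) ^ 2) * tripleCoeff (p ^ 2) n (j + 1)) := by
      funext j
      have hc := tripleCoeff_succ (pow_ne_zero 2 hp0) (norm_pow_lt_one hp two_ne_zero) n j
      have a1 : y * y ^ (j - 1) = y ^ j := by rw [zpow_sub_one₀ hy]; field_simp
      have a2 : y⁻¹ * y ^ (j + 1) = y ^ j := by rw [zpow_add_one₀ hy]; field_simp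
      have b1 : p ^ (2 * n + 1) * p ^ ((j - 1) ^ 2) =
          p ^ (j ^ 2) * (p ^ 2) ^ (n + 1 - j : ℤ) := by
        rw [← zpow_natCast p (2 * n + 1), ← zpow_natCast p 2, ← zpow_mul, ← zpow_add₀ hp0,
          ← zpow_add₀ hp0]
        congr 1; push_cast; ring
      have b2 : p ^ (2 * n + 1) * p ^ ((j + 1) ^ 2) =
          p ^ (j ^ 2) * (p ^ 2) ^ (n + 1 + j : ℤ) := by
        rw [← zpow_natCast p (2 * n + 1), ← zpow_natCast p 2, ← zpow_mul, ← zpow_add₀ hp0,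
          ← zpow_add₀ hp0]
        congr 1; push_cast; ring
      simp only [hc]
      rw [← pow_mul, show 2 * (2 * n + 1) = 4 * n + 2 by ring]
      linear_combination
        -(p ^ (2 * n + 1) * p ^ ((j - 1) ^ 2) * tripleCoeff (p ^ 2) n (j - 1)) * a1
        - (p ^ (2 * n + 1) * p ^ ((j + 1) ^ 2) * tripleCoeff (p ^ 2) n (j + 1)) * a2
        - y ^ j * tripleCoeff (p ^ 2) n (j - 1) * b1 - y ^ j * tripleCoeff (p ^ 2) n (j + 1) * b2
    have hv : (1 + y * p ^ (2 * n + 1)) * (1 + y⁻¹ * p ^ (2 * n + 1)) =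
        1 + p ^ (4 * n + 2) + y * p ^ (2 * n + 1) + y⁻¹ * p ^ (2 * n + 1) := by
      field_simp
      ring
    rw [hf, hv, mul_comm (Finset.prod _ _), add_mul, add_mul]
    exact hs

lemma tendsto_invPoch {q : ℂ} (hq : ‖q‖ < 1) :
    Tendsto (invPoch q) atTop (𝓝 (eulerE q)⁻¹) := by
  have ht : Tendsto Int.toNat atTop atTop :=
    tendsto_atTop.mpr fun n => (eventually_ge_atTop (n : ℤ)).mono fun k hk => by omega
  have h := ((multipliable_eulerE hq).tendsto_prod_tprod_nat.inv₀ (eulerE_ne_zero hq)).comp ht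
  refine h.congr' ((eventually_ge_atTop (0 : ℤ)).mono fun k hk => ?_)
  simp [invPoch, hk]

lemma exists_norm_invPoch_le {q : ℂ} (hq : ‖q‖ < 1) : ∃ K, ∀ k, ‖invPoch q k‖ ≤ K := by
  obtain ⟨K, hK⟩ := isBounded_iff_forall_norm_le.mp (Metric.isBounded_range_of_tendsto _
    ((tendsto_invPoch hq).comp (tendsto_natCast_atTop_atTop (R := ℤ))))
  refine ⟨K, fun k => ?_⟩
  have h0 := hK _ ⟨0, rfl⟩
  rcases le_or_gt 0 k with hk | hk
  · exact hK _ ⟨k.toNat, by simp [hk]⟩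
  · rw [invPoch, if_neg (not_le.mpr hk), norm_zero]
    exact (norm_nonneg _).trans h0

lemma tendsto_tripleCoeff {q : ℂ} (hq : ‖q‖ < 1) (j : ℤ) :
    Tendsto (fun n => tripleCoeff q n j) atTop (𝓝 (eulerE q)⁻¹) := by
  have hE := eulerE_ne_zero hq
  have hn : Tendsto (fun n : ℕ => (n : ℤ)) atTop atTop := tendsto_natCast_atTop_atTop
  have h1 := (multipliable_eulerE hq).tendsto_prod_tprod_nat.comp
    (tendsto_id.const_mul_atTop' (r := 2) two_pos)
  have h2 := (tendsto_invPoch hq).comp (tendsto_atTop_add_const_right _ j hn)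
  have h3 := (tendsto_invPoch hq).comp (tendsto_atTop_add_const_right _ (-j) hn)
  have h := h1.mul (h2.mul h3)
  change Tendsto _ _ (𝓝 (eulerE q * _)) at h
  rw [mul_inv_cancel_left₀ hE] at h
  exact h

lemma exists_norm_tripleCoeff_le {q : ℂ} (hq : ‖q‖ < 1) :
    ∃ K, ∀ n j, ‖tripleCoeff q n j‖ ≤ K := by
  obtain ⟨K, hK⟩ := exists_norm_invPoch_le hq
  obtain ⟨M, hM⟩ := isBounded_iff_forall_norm_le.mp (Metric.isBounded_range_of_tendsto _
    (multipliable_eulerE hq).tendsto_prod_tprod_nat)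
  have hK0 : 0 ≤ K := (norm_nonneg _).trans (hK 0)
  have hM0 : 0 ≤ M := (norm_nonneg _).trans (hM _ ⟨0, rfl⟩)
  refine ⟨M * (K * K), fun n j => ?_⟩
  rw [tripleCoeff, norm_mul, norm_mul]
  gcongr
  · exact hM _ ⟨2 * n, rfl⟩
  · exact hK _
  · exact hK _

lemma summable_norm_theta {y p : ℂ} (hy : ‖y‖ = 1) (hp : ‖p‖ < 1) :
    Summable fun j : ℤ => ‖y ^ j * p ^ (j ^ 2)‖ := by
  have hn : Summable fun n : ℕ => ‖p ^ ((n : ℤ) ^ 2)‖ := by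
    refine (summable_geometric_of_lt_one (norm_nonneg p) hp).of_nonneg_of_le
      (fun _ => norm_nonneg _) fun n => ?_
    rw [← Nat.cast_pow, zpow_natCast, norm_pow]
    exact pow_le_pow_of_le_one (norm_nonneg p) hp.le (Nat.le_self_pow two_ne_zero n)
  have h : Summable fun j : ℤ => ‖p ^ (j ^ 2)‖ :=
    summable_int_iff_summable_nat_and_neg.mpr ⟨hn, by simpa using hn⟩
  simpa [norm_mul, norm_zpow, hy] using h

/-- The Jacobi triple product. -/
theorem tsum_theta_eq {y p : ℂ} (hy : ‖y‖ = 1) (hp0 : p ≠ 0) (hp : ‖p‖ < 1) :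
    ∑' j : ℤ, y ^ j * p ^ (j ^ 2) = eulerE (p ^ 2) * (oddProd y p * oddProd y⁻¹ p) := by
  have hq := norm_pow_lt_one hp two_ne_zero
  have hy0 : y ≠ 0 := by rintro rfl; simp at hy
  obtain ⟨K, hK⟩ := exists_norm_tripleCoeff_le hq
  have hlim := tendsto_tsum_of_dominated_convergence ((summable_norm_theta hy hp).mul_right K)
    (f := fun n j => y ^ j * p ^ (j ^ 2) * tripleCoeff (p ^ 2) n j)
    (fun j => (tendsto_tripleCoeff hq j).const_mul (y ^ j * p ^ (j ^ 2)))
    (Eventually.of_forall fun n j => by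
      rw [norm_mul]
      exact mul_le_mul_of_nonneg_left (hK n j) (norm_nonneg _))
  simp only [(hasSum_finite_triple hy0 hp0 hp _).tsum_eq] at hlim
  have hprod := ((multipliable_oddProd y hp).mul
    (multipliable_oddProd y⁻¹ hp)).tendsto_prod_tprod_nat
  rw [(multipliable_oddProd y hp).tprod_mul (multipliable_oddProd y⁻¹ hp)] at hprod
  have h := tendsto_nhds_unique hlim hprod
  rw [tsum_mul_right, ← div_eq_mul_inv, div_eq_iff (eulerE_ne_zero hq)] at h
  rw [h, mul_comm]
  rfl

section Cubic

variable {ω : ℂ}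

lemma cube_eq_one_of_cyclotomic (hω : ω ^ 2 + ω + 1 = 0) : ω ^ 3 = 1 := by
  linear_combination (ω - 1) * hω

lemma ne_zero_of_cyclotomic (hω : ω ^ 2 + ω + 1 = 0) : ω ≠ 0 := by
  rintro rfl; simp at hω

lemma norm_eq_one_of_cyclotomic (hω : ω ^ 2 + ω + 1 = 0) : ‖ω‖ = 1 := by
  have h : ‖ω‖ ^ 3 = 1 := by rw [← norm_pow, cube_eq_one_of_cyclotomic hω, norm_one]
  exact (pow_eq_one_iff_of_nonneg (norm_nonneg ω) three_ne_zero).mp h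

lemma zpow_add_three_mul (hω : ω ^ 2 + ω + 1 = 0) (m n : ℤ) : ω ^ (m + 3 * n) = ω ^ m := by
  have h3 : ω ^ (3 : ℤ) = 1 := by exact_mod_cast cube_eq_one_of_cyclotomic hω
  rw [zpow_add₀ (ne_zero_of_cyclotomic hω), zpow_mul, h3, one_zpow, mul_one]

lemma one_add_zpow_add_zpow_neg (hω : ω ^ 2 + ω + 1 = 0) {s : ℤ} (hs : ¬ 3 ∣ s) :
    1 + ω ^ s + ω ^ (-s) = 0 := by
  have h2 : ω ^ (2 : ℤ) = ω ^ 2 := by norm_cast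
  obtain ⟨k, rfl | rfl⟩ : ∃ k, s = 1 + 3 * k ∨ s = 2 + 3 * k := ⟨s / 3, by omega⟩
  · rw [show -(1 + 3 * k) = 2 + 3 * (-k - 1) by ring, zpow_add_three_mul hω,
      zpow_add_three_mul hω, h2, zpow_one]
    linear_combination hω
  · rw [show -(2 + 3 * k) = 1 + 3 * (-k - 1) by ring, zpow_add_three_mul hω,
      zpow_add_three_mul hω, h2, zpow_one]
    linear_combination hω

/-- The summand of the Borweins' cubic theta function `b(q)`. -/
noncomputable def cubicTerm (ω q : ℂ) (x : ℤ × ℤ) : ℂ :=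
  ω ^ (x.1 - x.2) * q ^ (x.1 ^ 2 + x.1 * x.2 + x.2 ^ 2)

/-- The summand of the product of three theta series twisted by `1`, `ω`, `ω²`. -/
noncomputable def tripleTerm (ω p : ℂ) (x : ℤ × ℤ × ℤ) : ℂ :=
  ω ^ (x.2.1 - x.2.2) * p ^ (x.1 ^ 2 + x.2.1 ^ 2 + x.2.2 ^ 2)

lemma tripleTerm_eq_mul (hω : ω ^ 2 + ω + 1 = 0) {p : ℂ} (hp0 : p ≠ 0) (x : ℤ × ℤ × ℤ) :
    tripleTerm ω p x = (1 ^ x.1 * p ^ (x.1 ^ 2)) *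
      ((ω ^ x.2.1 * p ^ (x.2.1 ^ 2)) * ((ω ^ 2) ^ x.2.2 * p ^ (x.2.2 ^ 2))) := by
  have h : (ω ^ 2) ^ x.2.2 = ω ^ (-x.2.2) := by
    rw [← zpow_natCast, ← zpow_mul, ← zpow_add_three_mul hω (-x.2.2) x.2.2]
    congr 1; push_cast; ring
  rw [tripleTerm, h, zpow_add₀ hp0, zpow_add₀ hp0, sub_eq_add_neg,
    zpow_add₀ (ne_zero_of_cyclotomic hω), one_zpow]
  ring

lemma summable_tripleTerm (hω : ω ^ 2 + ω + 1 = 0) {p : ℂ} (hp0 : p ≠ 0) (hp : ‖p‖ < 1) :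
    Summable (tripleTerm ω p) := by
  have hn := norm_eq_one_of_cyclotomic hω
  have hn2 : ‖ω ^ 2‖ = 1 := by simp [hn]
  have h2 := (summable_norm_theta hn hp).mul_norm (summable_norm_theta hn2 hp)
  have h3 := summable_mul_of_summable_norm (summable_norm_theta norm_one hp) h2
  exact h3.congr fun x => (tripleTerm_eq_mul hω hp0 x).symm

lemma tsum_tripleTerm (hω : ω ^ 2 + ω + 1 = 0) {p : ℂ} (hp0 : p ≠ 0) (hp : ‖p‖ < 1) :
    ∑' x, tripleTerm ω p x = eulerE (p ^ 2) ^ 3 * oddProd 1 (p ^ 3) ^ 2 := by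
  have hn := norm_eq_one_of_cyclotomic hω
  have hn2 : ‖ω ^ 2‖ = 1 := by simp [hn]
  have hinv : ω⁻¹ = ω ^ 2 :=
    inv_eq_of_mul_eq_one_right (by linear_combination cube_eq_one_of_cyclotomic hω)
  have hinv2 : (ω ^ 2)⁻¹ = ω := by rw [← hinv, inv_inv]
  rw [tsum_congr (tripleTerm_eq_mul hω hp0),
    ← tsum_mul_tsum_of_summable_norm (summable_norm_theta norm_one hp)
      ((summable_norm_theta hn hp).mul_norm (summable_norm_theta hn2 hp)),
    ← tsum_mul_tsum_of_summable_norm (summable_norm_theta hn hp) (summable_norm_theta hn2 hp),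
    tsum_theta_eq norm_one hp0 hp, tsum_theta_eq hn hp0 hp, tsum_theta_eq hn2 hp0 hp, hinv,
    hinv2, inv_one, ← oddProd_cubic hω hp]
  ring

lemma summable_cubicTerm (hω : ω ^ 2 + ω + 1 = 0) {q : ℂ} (hq0 : q ≠ 0) (hq : ‖q‖ < 1) :
    Summable (cubicTerm ω q) := by
  obtain ⟨p, rfl⟩ := IsAlgClosed.exists_pow_nat_eq q two_pos
  have hp0 : p ≠ 0 := by rintro rfl; simp at hq0
  have hp : ‖p‖ < 1 := by
    rw [norm_pow] at hq
    exact (pow_lt_one_iff_of_nonneg (norm_nonneg p) two_ne_zero).mp hq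
  have h := (summable_tripleTerm hω hp0 hp).comp_injective
    (i := fun x : ℤ × ℤ => (-x.1 - x.2, x.1, x.2)) fun x y hxy => by
      simp only [Prod.mk.injEq] at hxy
      exact Prod.ext hxy.2.1 hxy.2.2
  refine h.congr fun x => ?_
  simp only [Function.comp, tripleTerm, cubicTerm]
  rw [← zpow_natCast, ← zpow_mul]
  congr 2; push_cast; ring

/-- Averaging over cyclic shifts kills the part of the triple sum off the lattice `3 ∣ a + b + c`,
and the rest factors. -/
lemma tsum_tripleTerm_eq_mul_tsum_cubicTerm (hω : ω ^ 2 + ω + 1 = 0) {p : ℂ} (hp0 : p ≠ 0)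
    (hp : ‖p‖ < 1) :
    ∑' x, tripleTerm ω p x =
      (∑' k : ℤ, 1 ^ k * (p ^ 3) ^ (k ^ 2)) * ∑' x, cubicTerm ω (p ^ 2) x := by
  let σ : ℤ × ℤ × ℤ ≃ ℤ × ℤ × ℤ :=
    ⟨fun x => (x.2.1, x.2.2, x.1), fun x => (x.2.2, x.1, x.2.1), fun _ => rfl, fun _ => rfl⟩
  let g : ℤ × ℤ × ℤ → ℤ × ℤ × ℤ := fun x => (x.1 - x.2.1 - x.2.2, x.1 + x.2.1, x.1 + x.2.2)
  have hg : Function.Injective g := fun x y hxy => by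
    simp only [g, Prod.mk.injEq] at hxy
    ext <;> omega
  have hω0 := ne_zero_of_cyclotomic hω
  have hF := (summable_tripleTerm hω hp0 hp).hasSum
  have hG := (hF.add (σ.hasSum_iff.mpr hF)).add (σ.hasSum_iff.mpr (σ.hasSum_iff.mpr hF))
  rw [← hg.hasSum_iff] at hG
  · have hp3 := norm_pow_lt_one hp three_ne_zero
    have hq := norm_pow_lt_one hp two_ne_zero
    have hval := hG.tsum_eq
    have hterm : ∀ x : ℤ × ℤ × ℤ, ((fun x => tripleTerm ω p x + (tripleTerm ω p ∘ σ) x +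
        ((tripleTerm ω p ∘ σ) ∘ σ) x) ∘ g) x =
        3 * ((1 ^ x.1 * (p ^ 3) ^ (x.1 ^ 2)) * cubicTerm ω (p ^ 2) x.2) := by
      rintro ⟨k, b, c⟩
      simp only [Function.comp, tripleTerm, cubicTerm, σ, g, Equiv.coe_fn_mk, one_zpow, one_mul]
      rw [show k + b - (k + c) = b - c by ring,
        show k + c - (k - b - c) = b - c + 3 * c by ring,
        show k - b - c - (k + b) = b - c + 3 * (-b) by ring, zpow_add_three_mul hω,
        zpow_add_three_mul hω, ← zpow_natCast p 3, ← zpow_natCast p 2, ← zpow_mul, ← zpow_mul,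
        mul_left_comm (p ^ _), ← zpow_add₀ hp0]
      push_cast
      ring_nf
    rw [tsum_congr hterm, tsum_mul_left, ← tsum_mul_tsum_of_summable_norm
      (summable_norm_theta norm_one hp3)
      (summable_cubicTerm hω (pow_ne_zero 2 hp0) hq).norm] at hval
    linear_combination -hval / 3
  · rintro ⟨a, b, c⟩ hx
    have hs : ¬ 3 ∣ a + b + c := by
      rintro ⟨k, hk⟩
      exact hx ⟨(k, b - k, c - k), by
        simp only [g, Prod.mk.injEq]
        omega⟩
    simp only [Function.comp, tripleTerm, σ, Equiv.coe_fn_mk]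
    rw [show c - a = b - c + -(a + b + c) + 3 * c by ring,
      show a - b = b - c + (a + b + c) + 3 * (-b) by ring, zpow_add_three_mul hω,
      zpow_add_three_mul hω, zpow_add₀ hω0, zpow_add₀ hω0,
      show b ^ 2 + c ^ 2 + a ^ 2 = a ^ 2 + b ^ 2 + c ^ 2 by ring,
      show c ^ 2 + a ^ 2 + b ^ 2 = a ^ 2 + b ^ 2 + c ^ 2 by ring]
    linear_combination ω ^ (b - c) * p ^ (a ^ 2 + b ^ 2 + c ^ 2) *
      one_add_zpow_add_zpow_neg hω hs

/-- The product formula `b(q) = E(q)³ / E(q³)` for the Borweins' cubic theta function. -/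
theorem tsum_cubicTerm (hω : ω ^ 2 + ω + 1 = 0) {q : ℂ} (hq0 : q ≠ 0) (hq : ‖q‖ < 1) :
    ∑' x, cubicTerm ω q x = eulerE q ^ 3 / eulerE (q ^ 3) := by
  obtain ⟨p, rfl⟩ := IsAlgClosed.exists_pow_nat_eq q two_pos
  have hp0 : p ≠ 0 := by rintro rfl; simp at hq0
  have hp : ‖p‖ < 1 := by
    rw [norm_pow] at hq
    exact (pow_lt_one_iff_of_nonneg (norm_nonneg p) two_ne_zero).mp hq
  have hp3 := norm_pow_lt_one hp three_ne_zero
  have h := tsum_tripleTerm_eq_mul_tsum_cubicTerm hω hp0 hp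
  rw [tsum_tripleTerm hω hp0 hp, tsum_theta_eq norm_one (pow_ne_zero 3 hp0) hp3, inv_one,
    pow_right_comm p 3 2] at h
  have hA := oddProd_ne_zero (z := 1) norm_one hp3
  have hE := eulerE_ne_zero (norm_pow_lt_one hq three_ne_zero)
  rw [eq_div_iff hE]
  refine mul_right_cancel₀ (pow_ne_zero 2 hA) ?_
  linear_combination -h

/-- The even part of `b(q)` is `b(q⁴)`. -/
lemma tsum_cubicTerm_add_neg (hω : ω ^ 2 + ω + 1 = 0) {q : ℂ} (hq0 : q ≠ 0) (hq : ‖q‖ < 1) :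
    ∑' x, cubicTerm ω q x + ∑' x, cubicTerm ω (-q) x = 2 * ∑' x, cubicTerm ω (q ^ 4) x := by
  let g : ℤ × ℤ → ℤ × ℤ := fun x => (2 * x.2, 2 * x.1)
  have hg : Function.Injective g := fun x y hxy => by
    simp only [g, Prod.mk.injEq] at hxy
    ext <;> omega
  rw [← (summable_cubicTerm hω hq0 hq).tsum_add
    (summable_cubicTerm hω (neg_ne_zero.mpr hq0) (by rwa [norm_neg])), ← tsum_mul_left,
    ← hg.tsum_eq]
  · refine tsum_congr fun x => ?_
    have he : Even ((2 * x.2) ^ 2 + 2 * x.2 * (2 * x.1) + (2 * x.1) ^ 2) :=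
      ⟨2 * x.2 ^ 2 + 2 * x.2 * x.1 + 2 * x.1 ^ 2, by ring⟩
    simp only [cubicTerm, g]
    rw [he.neg_zpow, show 2 * x.2 - 2 * x.1 = x.1 - x.2 + 3 * (x.2 - x.1) by ring,
      zpow_add_three_mul hω, ← zpow_natCast q 4, ← zpow_mul]
    push_cast
    ring_nf
  · rintro ⟨b, c⟩ hx
    by_contra hr
    apply hx
    have ho : Odd (b ^ 2 + b * c + c ^ 2) := by
      rw [← Int.not_even_iff_odd]
      intro he
      have hbc : Even b ∧ Even c := by
        rcases Int.even_or_odd b with hb | hb <;> rcases Int.even_or_odd c with hc | hc <;>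
          simp_all [Int.even_add, Int.even_mul, Int.even_pow, ← Int.not_even_iff_odd]
      obtain ⟨⟨m, hm⟩, n, hn⟩ := hbc
      exact hr ⟨(n, m), by simp only [g, Prod.mk.injEq]; omega⟩
    simp only [cubicTerm]
    rw [ho.neg_zpow]
    ring

end Cubic

/-- The even part of `E(q)³ / E(q³)` is `E(q⁴)³ / E(q¹²)`. -/
theorem eulerE_cube_div_add_neg {q : ℂ} (hq : ‖q‖ < 1) :
    eulerE q ^ 3 / eulerE (q ^ 3) + eulerE (-q) ^ 3 / eulerE (-q ^ 3) =
      2 * (eulerE (q ^ 4) ^ 3 / eulerE (q ^ 12)) := by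
  rcases eq_or_ne q 0 with rfl | hq0
  · norm_num [eulerE]
  obtain ⟨ω, hω⟩ : ∃ ω : ℂ, ω ^ 2 + ω + 1 = 0 := by
    have h := (Complex.isPrimitiveRoot_exp 3 three_ne_zero).geom_sum_eq_zero (by norm_num)
    refine ⟨Complex.exp (2 * Real.pi * Complex.I / (3 : ℕ)), Eq.trans ?_ h⟩
    rw [Finset.sum_range_succ, Finset.sum_range_succ, Finset.sum_range_one]
    ring
  have h := tsum_cubicTerm_add_neg hω hq0 hq
  rw [tsum_cubicTerm hω hq0 hq, tsum_cubicTerm hω (neg_ne_zero.mpr hq0) (by rwa [norm_neg]),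
    tsum_cubicTerm hω (pow_ne_zero 4 hq0) (norm_pow_lt_one hq four_ne_zero), ← pow_mul,
    Odd.neg_pow (by decide) q] at h
  exact h

/-- Eta-quotient identity:
$\frac{E(q^2)^7E(q^3)E(q^{12})}{E(q)^3E(q^4)^3E(q^6)}
 - \frac{2E(q^4)^3E(q^6)^2}{E(q^2)^2E(q^{12})} = -\frac{E(q)^3E(q^6)^2}{E(q^2)^2E(q^3)}$. -/
theorem eta_quotient_13_2 (q : ℂ) (hq : ‖q‖ < 1) :
    eulerE (q ^ 2) ^ 7 * eulerE (q ^ 3) * eulerE (q ^ 12) /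
        (eulerE q ^ 3 * eulerE (q ^ 4) ^ 3 * eulerE (q ^ 6))
      - 2 * eulerE (q ^ 4) ^ 3 * eulerE (q ^ 6) ^ 2 /
          (eulerE (q ^ 2) ^ 2 * eulerE (q ^ 12))
      = -(eulerE q ^ 3 * eulerE (q ^ 6) ^ 2 /
          (eulerE (q ^ 2) ^ 2 * eulerE (q ^ 3))) := by
  have hq3 := norm_pow_lt_one hq three_ne_zero
  have h := eulerE_cube_div_add_neg hq
  have hm := eulerE_mul_eulerE_neg hq
  have hm3 := eulerE_mul_eulerE_neg hq3
  simp only [← pow_mul] at hm3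
  norm_num at hm3
  have e1 := eulerE_ne_zero hq
  have e2 := eulerE_ne_zero (norm_pow_lt_one hq two_ne_zero)
  have e3 := eulerE_ne_zero hq3
  have e4 := eulerE_ne_zero (norm_pow_lt_one hq four_ne_zero)
  have e6 := eulerE_ne_zero (norm_pow_lt_one hq (n := 6) (by norm_num))
  have e12 := eulerE_ne_zero (norm_pow_lt_one hq (n := 12) (by norm_num))
  have hneg : eulerE (-q) = eulerE (q ^ 2) ^ 3 / (eulerE q * eulerE (q ^ 4)) := by
    rw [eq_div_iff (mul_ne_zero e1 e4), ← hm]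
    ring
  have hneg3 : eulerE (-q ^ 3) = eulerE (q ^ 6) ^ 3 / (eulerE (q ^ 3) * eulerE (q ^ 12)) := by
    rw [eq_div_iff (mul_ne_zero e3 e12), ← hm3]
    ring
  have hfirst : eulerE (q ^ 2) ^ 7 * eulerE (q ^ 3) * eulerE (q ^ 12) /
      (eulerE q ^ 3 * eulerE (q ^ 4) ^ 3 * eulerE (q ^ 6)) =
      eulerE (-q) ^ 3 / eulerE (-q ^ 3) * (eulerE (q ^ 6) ^ 2 / eulerE (q ^ 2) ^ 2) := by
    rw [hneg, hneg3]
    field_simp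
  rw [hfirst, eq_sub_of_add_eq' h]
  field_simp
  ring
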